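/- Assume f is proper and s-regular, let 1 ≤ i ≤ s, and assume i < m or d_m ≥ 2. Then there exists a sequence of positive reals c_{i,n} → 0 such that for every z ∈ K_{i−1} the sequence n ↦ G_{i,n}(z) + c_{i,n} is nonincreasing; the limit G_i(z) := lim_n G_{i,n}(z) is finite and nonnegative for z ∈ K_{i−1}, the function G_i is continuous on K_{i−1} (with its relative topology), satisfies G_i(f(z)) = d_i·G_i(z) and G_i(z) ≤ log^+|z| + c_{i,0} for all z ∈ K_{i−1}, and one has {z ∈ K_{i−1} : G_i(z) = 0} = K_i and G_i(z) > 0 for every z ∈ U_i. -/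

import Mathlib

open MvPolynomial Filter Topology Metric Set

noncomputable section

def logPlus (x : ℝ) : ℝ := max (Real.log x) 0

/-- The top-degree homogeneous part of the `j`-th coordinate polynomial of `P`. -/
def pPlus (k : ℕ) (P : Fin k → MvPolynomial (Fin k) ℂ) (j : Fin k) :
    MvPolynomial (Fin k) ℂ :=
  homogeneousComponent (P j).totalDegree (P j)

/-- `Σ_i`: unit-sphere slice of the affine cone over the attracting set `X_i` at
infinity: `‖w‖ = 1`, `P⁺_{(1)}(w) = ⋯ = P⁺_{(i−1)}(w) = 0` and `w_{(>i)} = 0`. -/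
def sigmaSet (k : ℕ) (P : Fin k → MvPolynomial (Fin k) ℂ) (l : ℕ → ℕ) (i : ℕ) :
    Set (EuclideanSpace ℂ (Fin k)) :=
  {w | ‖w‖ = 1 ∧ (∀ j : Fin k, (j : ℕ) < l (i - 1) → eval (fun t => w t) (pPlus k P j) = 0) ∧
    ∀ j : Fin k, l i ≤ (j : ℕ) → w j = 0}

/-- `U_i`: basin of the attracting set `X_i` at infinity. -/
def basin (k : ℕ) (f : EuclideanSpace ℂ (Fin k) → EuclideanSpace ℂ (Fin k))
    (P : Fin k → MvPolynomial (Fin k) ℂ) (l : ℕ → ℕ) (i : ℕ) :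
    Set (EuclideanSpace ℂ (Fin k)) :=
  {z | Tendsto (fun n => ‖f^[n] z‖) atTop atTop ∧
    Tendsto (fun n => infDist (‖f^[n] z‖⁻¹ • f^[n] z) (sigmaSet k P l i)) atTop (𝓝 0)}

/-- `K_i = K_{i−1} \ U_i` (with `K_0 = ℂ^k`), unfolded as the complement of
`U_1 ∪ ⋯ ∪ U_i`. -/
def kSet (k : ℕ) (f : EuclideanSpace ℂ (Fin k) → EuclideanSpace ℂ (Fin k))
    (P : Fin k → MvPolynomial (Fin k) ℂ) (l : ℕ → ℕ) (i : ℕ) :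
    Set (EuclideanSpace ℂ (Fin k)) :=
  {z | ∀ j : ℕ, 1 ≤ j → j ≤ i → z ∉ basin k f P l j}

/-- Euclidean norm of the sub-vector of the coordinates `a ≤ j < b`. -/
def blockNorm (k : ℕ) (z : EuclideanSpace ℂ (Fin k)) (a b : ℕ) : ℝ :=
  Real.sqrt (∑ j : Fin k, if a ≤ (j : ℕ) ∧ (j : ℕ) < b then ‖z j‖ ^ 2 else 0)

end

theorem exists_ne_zero_common_zero {k : ℕ} {ι : Type*} [Fintype ι]
    (F : ι → MvPolynomial (Fin k) ℂ) (hF : ∀ t, eval 0 (F t) = 0) (hι : Fintype.card ι < k) :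
    ∃ z : Fin k → ℂ, z ≠ 0 ∧ ∀ t, eval z (F t) = 0 := by
  by_contra! H
  have hdim : ringKrullDim (MvPolynomial (Fin k) ℂ) = k := by
    rw [MvPolynomial.ringKrullDim_of_isNoetherianRing, ringKrullDim_eq_zero_of_field]
    simp
  have : FiniteRingKrullDim (MvPolynomial (Fin k) ℂ) := by
    rw [finiteRingKrullDim_iff_ne_bot_and_top, hdim]
    refine ⟨WithBot.natCast_ne_bot k, fun h => ENat.natCast_ne_top k ?_⟩
    exact WithBot.coe_injective h
  obtain ⟨M, hM, hMh⟩ := Ideal.exists_isMaximal_height (R := MvPolynomial (Fin k) ℂ)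
  obtain ⟨x, rfl⟩ := isMaximal_iff_eq_vanishingIdeal_singleton.1 hM
  have heval : ∀ z t, eval z (aeval (fun j => X j - C (x j)) (F t)) =
      eval (z - x) (F t) := by
    intro z t
    rw [← aeval_eq_eval, ← aeval_eq_eval, ← AlgHom.comp_apply, comp_aeval]
    congr 2
    ext j
    simp
  set S : Set (MvPolynomial (Fin k) ℂ) :=
    range fun t => aeval (fun j => X j - C (x j)) (F t) with hS
  have hzl : zeroLocus ℂ (Ideal.span S) = {x} := by
    ext z
    rw [zeroLocus_span]
    simp only [hS, mem_ofPred_eq, forall_mem_range, mem_singleton_iff]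
    constructor
    · intro h
      by_contra hzx
      obtain ⟨t, ht⟩ := H (z - x) (sub_ne_zero.2 hzx)
      exact ht ((heval z t).symm.trans (h t))
    · rintro rfl t
      refine (heval z t).trans ?_
      simpa using hF t
  have hrad := vanishingIdeal_zeroLocus_eq_radical (K := ℂ) (Ideal.span S)
  rw [hzl] at hrad
  have hmin : vanishingIdeal ℂ {x} ∈ (Ideal.span S).minimalPrimes := by
    rw [← Ideal.radical_minimalPrimes, ← hrad]
    have := hM.isPrime
    rw [Ideal.minimalPrimes_eq_subsingleton_self]
    rfl
  have hle := Ideal.height_le_card_of_mem_minimalPrimes_span (finite_range _) hmin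
  have hcard : S.ncard ≤ Fintype.card ι := by
    rw [hS, ← image_univ]
    refine (ncard_image_le finite_univ).trans ?_
    simp [ncard_univ]
  have hht : (vanishingIdeal ℂ {x} : Ideal (MvPolynomial (Fin k) ℂ)).height = k := by
    rw [hdim] at hMh
    exact WithBot.coe_injective hMh
  rw [hht] at hle
  have := Nat.cast_le.1 hle
  lia

theorem logPlus_eq_posLog : logPlus = Real.posLog := by
  ext x
  exact max_comm _ _

theorem logPlus_nonneg (x : ℝ) : 0 ≤ logPlus x := le_max_right _ _

theorem exists_green_function {E : Type*} [NormedAddCommGroup E] {f : E → E}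
    (hf : Continuous f) {K U D : Set E} (hD : IsOpen D) (hK : MapsTo f K K)
    (hU : MapsTo f (K \ U) (K \ U)) {q : ℕ} (hq : 2 ≤ q) {A A' B : ℝ} (hA : 0 < A) (hB : 0 ≤ B)
    (hupper : ∀ w ∈ K, logPlus ‖f w‖ ≤ A + q * logPlus ‖w‖)
    (hDf : MapsTo f (K ∩ D) D)
    (hlower : ∀ w ∈ K ∩ D, q * logPlus ‖w‖ ≤ logPlus ‖f w‖ + B)
    (hBD : ∀ w ∈ K ∩ D, B < logPlus ‖w‖)
    (hUD : ∀ z ∈ K ∩ U, ∃ N, f^[N] z ∈ D)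
    (hslow : ∀ z ∈ K \ U, logPlus ‖f z‖ ≤ A' + (q - 1) * logPlus ‖z‖) :
    ∃ cseq : ℕ → ℝ, (∀ n, 0 < cseq n) ∧ Tendsto cseq atTop (𝓝 0) ∧
      (∀ z ∈ K, Antitone fun n : ℕ =>
        ((q : ℝ) ^ n)⁻¹ * logPlus ‖f^[n] z‖ + cseq n) ∧
      ∃ G : E → ℝ,
        (∀ z ∈ K,
          Tendsto (fun n : ℕ => ((q : ℝ) ^ n)⁻¹ * logPlus ‖f^[n] z‖) atTop (𝓝 (G z)) ∧
          0 ≤ G z ∧ G (f z) = (q : ℝ) * G z ∧ G z ≤ logPlus ‖z‖ + cseq 0) ∧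
        ContinuousOn G K ∧
        {z ∈ K | G z = 0} = K \ U ∧
        ∀ z ∈ U, 0 < G z := by
  have hq2 : (2 : ℝ) ≤ q := by exact_mod_cast hq
  have hq0 : (0 : ℝ) < q := by linarith
  have hqn : ∀ n : ℕ, 0 < ((q : ℝ) ^ n)⁻¹ := fun n => by positivity
  have hqlim : Tendsto (fun n : ℕ => ((q : ℝ) ^ n)⁻¹) atTop (𝓝 0) :=
    tendsto_inv_atTop_zero.comp (tendsto_pow_atTop_atTop_of_one_lt (by linarith))
  have hclim : Tendsto (fun n : ℕ => A * ((q : ℝ) ^ n)⁻¹) atTop (𝓝 0) := by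
    simpa using hqlim.const_mul A
  have hKn : ∀ n, ∀ z ∈ K, f^[n] z ∈ K := fun n => hK.iterate n
  have hanti : ∀ z ∈ K, Antitone fun n : ℕ =>
      ((q : ℝ) ^ n)⁻¹ * logPlus ‖f^[n] z‖ + A * ((q : ℝ) ^ n)⁻¹ := by
    intro z hz
    refine antitone_nat_of_succ_le fun n => ?_
    have h := hupper _ (hKn n z hz)
    rw [Function.iterate_succ_apply', pow_succ, mul_inv]
    have hqi : (q : ℝ)⁻¹ * logPlus ‖f (f^[n] z)‖ + A * (q : ℝ)⁻¹ ≤ logPlus ‖f^[n] z‖ + A := by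
      rw [← mul_le_mul_iff_right₀ hq0]
      field_simp
      nlinarith
    calc _ = ((q : ℝ) ^ n)⁻¹ * ((q : ℝ)⁻¹ * logPlus ‖f (f^[n] z)‖ + A * (q : ℝ)⁻¹) := by ring
      _ ≤ ((q : ℝ) ^ n)⁻¹ * (logPlus ‖f^[n] z‖ + A) := by gcongr
      _ = _ := by ring
  have hex : ∀ z, ∃ L : ℝ, (z ∈ K →
      Tendsto (fun n : ℕ => ((q : ℝ) ^ n)⁻¹ * logPlus ‖f^[n] z‖) atTop (𝓝 L)) ∧
      (z ∉ K → L = 1) := by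
    intro z
    by_cases hz : z ∈ K
    · have hbdd : BddBelow (range fun n : ℕ =>
          ((q : ℝ) ^ n)⁻¹ * logPlus ‖f^[n] z‖ + A * ((q : ℝ) ^ n)⁻¹) := by
        refine ⟨0, ?_⟩
        rintro _ ⟨n, rfl⟩
        have := mul_nonneg (hqn n).le (logPlus_nonneg ‖f^[n] z‖)
        have := mul_pos hA (hqn n)
        simp only
        linarith
      have := (tendsto_atTop_ciInf (hanti z hz) hbdd).sub hclim
      simp only [add_sub_cancel_right, sub_zero] at this
      exact ⟨_, fun _ => this, fun h => absurd hz h⟩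
    · exact ⟨1, fun h => absurd h hz, fun _ => rfl⟩
  choose G hG hG1 using hex
  have hGnonneg : ∀ z ∈ K, 0 ≤ G z := fun z hz =>
    ge_of_tendsto' (hG z hz) fun n => mul_nonneg (hqn n).le (logPlus_nonneg _)
  have hGf : ∀ z ∈ K, G (f z) = q * G z := by
    intro z hz
    refine tendsto_nhds_unique (hG (f z) (hK hz)) ?_
    refine (((tendsto_add_atTop_iff_nat 1).2 (hG z hz)).const_mul (q : ℝ)).congr fun n => ?_
    rw [Function.iterate_succ_apply, pow_succ]
    field_simp
  have hGfn : ∀ n, ∀ z ∈ K, G z = ((q : ℝ) ^ n)⁻¹ * G (f^[n] z) := by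
    intro n z hz
    induction n with
    | zero => simp
    | succ n ih =>
      rw [Function.iterate_succ_apply', hGf _ (hKn n z hz), ih, pow_succ]
      field_simp
  have hGle : ∀ z ∈ K, ∀ n : ℕ,
      G z ≤ ((q : ℝ) ^ n)⁻¹ * logPlus ‖f^[n] z‖ + A * ((q : ℝ) ^ n)⁻¹ := by
    intro z hz n
    have h := (hG z hz).add hclim
    rw [add_zero] at h
    exact (hanti z hz).le_of_tendsto h n
  have hGD : ∀ w ∈ K ∩ D, logPlus ‖w‖ - B ≤ G w := by
    intro w hw
    have hwD : ∀ n, f^[n] w ∈ K ∩ D := fun n =>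
      (show MapsTo f (K ∩ D) (K ∩ D) from fun x hx => ⟨hK hx.1, hDf hx⟩).iterate n hw
    have hgrow : ∀ n : ℕ, (q : ℝ) ^ n * (logPlus ‖w‖ - B) ≤ logPlus ‖f^[n] w‖ - B := by
      intro n
      induction n with
      | zero => simp
      | succ n ih =>
        have h := hlower _ (hwD n)
        rw [Function.iterate_succ_apply', pow_succ]
        nlinarith
    refine ge_of_tendsto' (hG w hw.1) fun n => ?_
    have h := hgrow n
    rw [inv_mul_eq_div, le_div_iff₀ (by positivity)]
    linarith
  have hGU : ∀ z ∈ U, 0 < G z := by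
    intro z hz
    by_cases hzK : z ∈ K
    · obtain ⟨N, hN⟩ := hUD z ⟨hzK, hz⟩
      rw [hGfn N z hzK]
      have h := hGD _ ⟨hKn N z hzK, hN⟩
      have h' := hBD _ ⟨hKn N z hzK, hN⟩
      exact mul_pos (hqn N) (by linarith)
    · rw [hG1 z hzK]
      exact one_pos
  have hGnU : ∀ z ∈ K \ U, G z = 0 := by
    intro z hz
    refine le_antisymm ?_ (hGnonneg z hz.1)
    have hlim : Tendsto (fun n : ℕ => A' * ((q : ℝ) ^ n)⁻¹ +
        (q - 1) * (((q : ℝ) ^ n)⁻¹ * logPlus ‖f^[n] z‖)) atTop (𝓝 (A' * 0 + (q - 1) * G z)) :=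
      (hqlim.const_mul A').add ((hG z hz.1).const_mul _)
    have h : G (f z) ≤ A' * 0 + (q - 1) * G z := by
      refine le_of_tendsto_of_tendsto' (hG (f z) (hK hz.1)) hlim fun n => ?_
      have h := hslow _ (hU.iterate n hz)
      rw [← Function.iterate_succ_apply, Function.iterate_succ_apply']
      calc _ ≤ ((q : ℝ) ^ n)⁻¹ * (A' + (q - 1) * logPlus ‖f^[n] z‖) := by
            have := (hqn n).le
            gcongr
        _ = _ := by ring
    rw [hGf z hz.1] at h
    linarith
  have hcontn : ∀ n : ℕ, Continuous fun z => ((q : ℝ) ^ n)⁻¹ * logPlus ‖f^[n] z‖ := by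
    intro n
    rw [logPlus_eq_posLog]
    exact continuous_const.mul (Real.continuous_posLog.comp (hf.iterate n).norm)
  refine ⟨fun n => A * ((q : ℝ) ^ n)⁻¹, fun n => mul_pos hA (hqn n), hclim, hanti, G,
    fun z hz => ⟨hG z hz, hGnonneg z hz, hGf z hz, by simpa using hGle z hz 0⟩, ?_, ?_, hGU⟩
  · intro z hz
    refine tendsto_order.2 ⟨fun y hy => ?_, fun y hy => ?_⟩
    · by_cases hzU : z ∈ U
      · obtain ⟨N, hN⟩ := hUD z ⟨hz, hzU⟩
        have hlim : Tendsto (fun n : ℕ => ((q : ℝ) ^ n)⁻¹ * logPlus ‖f^[n] z‖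
            - B * ((q : ℝ) ^ n)⁻¹) atTop (𝓝 (G z)) := by
          simpa using (hG z hz).sub (hqlim.const_mul B)
        obtain ⟨n, hn, hNn⟩ := ((hlim.eventually (lt_mem_nhds hy)).and
          (eventually_ge_atTop N)).exists
        have hopen : ∀ᶠ x in 𝓝 z, f^[N] x ∈ D :=
          (hf.iterate N).continuousAt.eventually (hD.mem_nhds hN)
        have hnear : ∀ᶠ x in 𝓝 z, y < ((q : ℝ) ^ n)⁻¹ * logPlus ‖f^[n] x‖
            - B * ((q : ℝ) ^ n)⁻¹ :=
          ((hcontn n).sub continuous_const).continuousAt.eventually (lt_mem_nhds hn)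
        filter_upwards [nhdsWithin_le_nhds hopen, nhdsWithin_le_nhds hnear,
          self_mem_nhdsWithin] with x hxD hxy hxK
        have hxn : f^[n] x ∈ K ∩ D := by
          obtain ⟨j, rfl⟩ := Nat.exists_eq_add_of_le hNn
          rw [add_comm, Function.iterate_add_apply]
          exact (show MapsTo f (K ∩ D) (K ∩ D) from fun x hx => ⟨hK hx.1, hDf hx⟩).iterate j
            ⟨hKn N x hxK, hxD⟩
        rw [hGfn n x hxK]
        have := mul_le_mul_of_nonneg_left (hGD _ hxn) (hqn n).le
        linarith
      · rw [hGnU z ⟨hz, hzU⟩] at hy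
        filter_upwards [self_mem_nhdsWithin] with x hx
        exact hy.trans_le (hGnonneg x hx)
    · have hlim := (hG z hz).add hclim
      rw [add_zero] at hlim
      obtain ⟨n, hn⟩ := (hlim.eventually (gt_mem_nhds hy)).exists
      have hnear := ((hcontn n).add
        (continuous_const (y := A * ((q : ℝ) ^ n)⁻¹))).continuousAt.eventually (gt_mem_nhds hn)
      filter_upwards [nhdsWithin_le_nhds hnear, self_mem_nhdsWithin] with x hx hxK
      exact (hGle x hxK n).trans_lt hx
  · ext z
    refine ⟨fun h => ⟨h.1, fun hzU => (hGU z hzU).ne' h.2⟩, fun h => ⟨h.1, hGnU z h⟩⟩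

theorem MvPolynomial.IsHomogeneous.eval_mul_left {σ R : Type*} [CommSemiring R]
    {p : MvPolynomial σ R} {n : ℕ} (hp : p.IsHomogeneous n) (c : R) (z : σ → R) :
    eval (fun j => c * z j) p = c ^ n * eval z p := by
  rw [eval_eq, eval_eq, Finset.mul_sum]
  refine Finset.sum_congr rfl fun s hs => ?_
  have hdeg : ∑ j ∈ s.support, s j = n := by
    rw [← hp (mem_support_iff.1 hs), Finsupp.weight_apply]
    simp [Finsupp.sum]
  simp only [mul_pow, Finset.prod_mul_distrib, Finset.prod_pow_eq_pow_sum, hdeg]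
  ring

theorem MvPolynomial.norm_eval_le_of_totalDegree_le {σ 𝕜 : Type*} [NormedField 𝕜]
    {p : MvPolynomial σ 𝕜} {n : ℕ} (hp : p.totalDegree ≤ n) {M : ℝ} (hM : 1 ≤ M) {z : σ → 𝕜}
    (hz : ∀ j, ‖z j‖ ≤ M) :
    ‖eval z p‖ ≤ (∑ s ∈ p.support, ‖coeff s p‖) * M ^ n := by
  rw [eval_eq, Finset.sum_mul]
  refine (norm_sum_le _ _).trans (Finset.sum_le_sum fun s hs => ?_)
  rw [norm_mul, norm_prod]
  gcongr
  calc ∏ j ∈ s.support, ‖z j ^ s j‖ ≤ ∏ j ∈ s.support, M ^ s j := by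
        refine Finset.prod_le_prod (fun _ _ => norm_nonneg _) fun j _ => ?_
        rw [norm_pow]
        gcongr
        exact hz j
    _ = M ^ ∑ j ∈ s.support, s j := Finset.prod_pow_eq_pow_sum _ _ _
    _ ≤ M ^ n := pow_le_pow_right₀ hM ((le_totalDegree hs).trans hp)

theorem MvPolynomial.totalDegree_sub_homogeneousComponent_le {σ R : Type*} [CommRing R]
    (p : MvPolynomial σ R) :
    (p - homogeneousComponent p.totalDegree p).totalDegree ≤ p.totalDegree - 1 := by
  rcases Nat.eq_zero_or_pos p.totalDegree with h0 | hpos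
  · rw [h0, homogeneousComponent_zero, ← totalDegree_eq_zero_iff_eq_C.1 h0]
    simp
  have hsum := sum_homogeneousComponent p
  rw [Finset.sum_range_succ] at hsum
  rw [← eq_sub_iff_add_eq.2 hsum]
  refine totalDegree_finsetSum_le fun j hj => ?_
  have := (homogeneousComponent_isHomogeneous j p).totalDegree_le
  have := Finset.mem_range.1 hj
  lia

theorem exists_norm_eval_le {k : ℕ} (P : Fin k → MvPolynomial (Fin k) ℂ) :
    ∃ C : ℝ, 0 < C ∧
      ∀ t n, (P t).totalDegree ≤ n → ∀ z : EuclideanSpace ℂ (Fin k), ∀ M, 1 ≤ M → ‖z‖ ≤ M →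
        ‖eval (fun j => z j) (P t)‖ ≤ C * M ^ n := by
  refine ⟨1 + ∑ t, ∑ s ∈ (P t).support, ‖coeff s (P t)‖, by positivity, ?_⟩
  intro t n ht z M hM hz
  refine (norm_eval_le_of_totalDegree_le ht hM fun j =>
    (PiLp.norm_apply_le z j).trans hz).trans ?_
  gcongr
  have := Finset.single_le_sum (f := fun t => ∑ s ∈ (P t).support, ‖coeff s (P t)‖)
    (fun t _ => by positivity) (Finset.mem_univ t)
  linarith

theorem exists_norm_eval_sub_pPlus_le {k : ℕ} (P : Fin k → MvPolynomial (Fin k) ℂ) :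
    ∃ C : ℝ, 0 < C ∧ ∀ t, ∀ z : EuclideanSpace ℂ (Fin k), 1 ≤ ‖z‖ →
      ‖eval (fun j => z j) (P t) - eval (fun j => z j) (pPlus k P t)‖
        ≤ C * ‖z‖ ^ ((P t).totalDegree - 1) := by
  obtain ⟨C, hC, h⟩ := exists_norm_eval_le fun t => P t - pPlus k P t
  refine ⟨C, hC, fun t z hz => ?_⟩
  rw [← map_sub]
  exact h t _ (totalDegree_sub_homogeneousComponent_le (P t)) z _ hz le_rfl

theorem norm_eval_pPlus_normalize {k : ℕ} (P : Fin k → MvPolynomial (Fin k) ℂ) (t : Fin k)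
    (z : EuclideanSpace ℂ (Fin k)) :
    ‖eval (fun j => (‖z‖⁻¹ • z) j) (pPlus k P t)‖ =
      ‖eval (fun j => z j) (pPlus k P t)‖ / ‖z‖ ^ (P t).totalDegree := by
  have h := (homogeneousComponent_isHomogeneous (P t).totalDegree (P t)).eval_mul_left
    ((‖z‖⁻¹ : ℝ) : ℂ) fun j => z j
  have h2 : (fun j => (‖z‖⁻¹ • z) j) = fun j => ((‖z‖⁻¹ : ℝ) : ℂ) * z j := by
    ext j
    simp
  rw [h2, pPlus, h, norm_mul, norm_pow]
  simp [div_eq_inv_mul]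

theorem tendsto_zero_of_isCompact {X : Type*} [TopologicalSpace X] {S : Set X} (hS : IsCompact S)
    {φ ψ : X → ℝ} (hφ : Continuous φ) (hψ : Continuous ψ) (hφ0 : ∀ x, 0 ≤ φ x)
    (hψ0 : ∀ x, 0 ≤ ψ x) (h : ∀ x ∈ S, φ x = 0 → ψ x = 0) {u : ℕ → X}
    (hu : ∀ᶠ n in atTop, u n ∈ S) (hlim : Tendsto (fun n => φ (u n)) atTop (𝓝 0)) :
    Tendsto (fun n => ψ (u n)) atTop (𝓝 0) := by
  refine tendsto_order.2 ⟨fun y hy => .of_forall fun n => hy.trans_le (hψ0 _), fun ε hε => ?_⟩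
  obtain ⟨δ, hδ, hmin⟩ := (hS.inter_right (isClosed_le continuous_const hψ)).exists_forall_le'
    (f := φ) (a := 0) hφ.continuousOn (s := S ∩ {x | ε ≤ ψ x}) fun x hx =>
      (hφ0 x).lt_of_ne fun h0 => (hε.trans_le hx.2).ne' (h x hx.1 h0.symm)
  filter_upwards [hu, hlim.eventually (gt_mem_nhds hδ)] with n hn hn'
  by_contra! hge
  exact (hmin _ ⟨hn, hge⟩).not_gt hn'

/-- A continuous function whose zeros on the unit sphere are the common zeros of the leading forms
of index `< a` and of the coordinates of index `≥ b`. -/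
noncomputable def coneGauge (k : ℕ) (P : Fin k → MvPolynomial (Fin k) ℂ) (a b : ℕ)
    (u : EuclideanSpace ℂ (Fin k)) : ℝ :=
  ∑ t : Fin k, ((if (t : ℕ) < a then ‖eval (fun j => u j) (pPlus k P t)‖ else 0) +
    if b ≤ (t : ℕ) then ‖u t‖ else 0)

section ConeGauge

variable {k : ℕ} {P : Fin k → MvPolynomial (Fin k) ℂ} {a b : ℕ}

theorem continuous_eval_euclidean (p : MvPolynomial (Fin k) ℂ) :
    Continuous fun u : EuclideanSpace ℂ (Fin k) => eval (fun j => u j) p :=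
  (continuous_eval p).comp (by fun_prop)

theorem continuous_coneGauge : Continuous (coneGauge k P a b) := by
  refine continuous_finsetSum _ fun t _ => Continuous.add ?_ ?_
  · split_ifs
    · exact (continuous_eval_euclidean _).norm
    · exact continuous_const
  · split_ifs
    · fun_prop
    · exact continuous_const

theorem coneGauge_nonneg (u : EuclideanSpace ℂ (Fin k)) : 0 ≤ coneGauge k P a b u :=
  Finset.sum_nonneg fun t _ => by positivity

theorem coneGauge_eq_zero_iff {u : EuclideanSpace ℂ (Fin k)} : coneGauge k P a b u = 0 ↔
    (∀ t : Fin k, (t : ℕ) < a → eval (fun j => u j) (pPlus k P t) = 0) ∧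
      ∀ t : Fin k, b ≤ (t : ℕ) → u t = 0 := by
  rw [coneGauge, Finset.sum_eq_zero_iff_of_nonneg fun t _ => by positivity, ← forall_and]
  refine forall_congr' fun t => ?_
  rw [add_eq_zero_iff_of_nonneg (by positivity) (by positivity)]
  simp

theorem norm_apply_le_coneGauge (u : EuclideanSpace ℂ (Fin k)) {t : Fin k} (ht : b ≤ (t : ℕ)) :
    ‖u t‖ ≤ coneGauge k P a b u := by
  refine le_trans ?_ (Finset.single_le_sum (fun t _ => by positivity) (Finset.mem_univ t))
  rw [if_pos ht]
  exact le_add_of_nonneg_left (by positivity)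

/-- Quantitative form of regularity: if the only common zero is `0`, then on the unit sphere one
of the forms or coordinates is bounded below. -/
theorem exists_lt_of_regular
    (hreg : ∀ z : Fin k → ℂ, (∀ t : Fin k, (t : ℕ) < b → eval z (pPlus k P t) = 0) →
      (∀ t : Fin k, b ≤ (t : ℕ) → z t = 0) → z = 0) :
    ∃ ε : ℝ, 0 < ε ∧ ∀ u : EuclideanSpace ℂ (Fin k), ‖u‖ = 1 →
      (∃ t : Fin k, (t : ℕ) < b ∧ ε < ‖eval (fun j => u j) (pPlus k P t)‖) ∨
        ∃ t : Fin k, b ≤ (t : ℕ) ∧ ε < ‖u t‖ := by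
  obtain ⟨δ, hδ, hmin⟩ := (isCompact_sphere (0 : EuclideanSpace ℂ (Fin k)) 1).exists_forall_le'
    (f := coneGauge k P b b) (a := 0) continuous_coneGauge.continuousOn fun u hu => by
      refine (coneGauge_nonneg u).lt_of_ne fun h0 => ?_
      have h0 := coneGauge_eq_zero_iff.1 h0.symm
      have hz := hreg (fun j => u j) h0.1 h0.2
      have : u = 0 := by
        ext j
        exact congrFun hz j
      simp [this] at hu
  refine ⟨δ / (k + 1), by positivity, fun u hu => ?_⟩
  by_contra! H
  have hle : coneGauge k P b b u ≤ ∑ _t : Fin k, δ / (k + 1) := by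
    refine Finset.sum_le_sum fun t _ => ?_
    rcases lt_or_ge (t : ℕ) b with htb | htb
    · simpa [htb, not_le.2 htb] using H.1 t htb
    · simpa [htb, not_lt.2 htb] using H.2 t htb
  have hlt : (k : ℝ) * (δ / (k + 1)) < δ := by
    rw [mul_div_assoc', div_lt_iff₀ (by positivity)]
    linarith
  have := hmin u (by simpa using hu)
  simp only [Finset.sum_const, Finset.card_univ, Fintype.card_fin, nsmul_eq_mul] at hle
  linarith

end ConeGauge

/-- The points of norm greater than `R` whose coordinates of index `≥ b` are small relative to
their norm. -/
def trap (k b : ℕ) (R ε : ℝ) : Set (EuclideanSpace ℂ (Fin k)) :=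
  {w | R < ‖w‖ ∧ ∀ t : Fin k, b ≤ (t : ℕ) → ‖w t‖ < ε * ‖w‖}

theorem isOpen_trap (k b : ℕ) (R ε : ℝ) : IsOpen (trap k b R ε) := by
  have : trap k b R ε = {w | R < ‖w‖} ∩ ⋂ t : Fin k, ⋂ _ : b ≤ (t : ℕ), {w | ‖w t‖ < ε * ‖w‖} := by
    ext w
    simp [trap]
  rw [this]
  refine (isOpen_lt continuous_const continuous_norm).inter
    (isOpen_iInter_of_finite fun t => isOpen_iInter_of_finite fun _ => ?_)
  exact isOpen_lt (by fun_prop) (by fun_prop)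

section Trap

variable {k : ℕ} {P : Fin k → MvPolynomial (Fin k) ℂ}
  {f : EuclideanSpace ℂ (Fin k) → EuclideanSpace ℂ (Fin k)}

theorem exists_trap {a b n : ℕ} {K : Set (EuclideanSpace ℂ (Fin k))}
    (hf : ∀ z j, f z j = eval (fun t => z t) (P j)) (hn : 2 ≤ n)
    (hlow : ∀ t : Fin k, (t : ℕ) < a → n < (P t).totalDegree)
    (hmid : ∀ t : Fin k, a ≤ (t : ℕ) → (t : ℕ) < b → (P t).totalDegree = n)
    (hhigh : ∀ t : Fin k, b ≤ (t : ℕ) → (P t).totalDegree < n)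
    (hreg : ∀ z : Fin k → ℂ, (∀ t : Fin k, (t : ℕ) < b → eval z (pPlus k P t) = 0) →
      (∀ t : Fin k, b ≤ (t : ℕ) → z t = 0) → z = 0)
    (hbound : ∃ C : ℝ, 0 < C ∧ ∀ w ∈ K, ‖f w‖ ≤ C * max 1 ‖w‖ ^ n) :
    ∃ C c ε R : ℝ, 0 < C ∧ 0 < c ∧ 0 < ε ∧ 1 ≤ R ∧
      (∀ w ∈ K, 1 ≤ ‖w‖ → ∀ t : Fin k, (t : ℕ) < a →
        ‖eval (fun j => (‖w‖⁻¹ • w) j) (pPlus k P t)‖ ≤ C / ‖w‖) ∧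
      ∀ w ∈ K ∩ trap k b R ε, f w ∈ trap k b R ε ∧ c * ‖w‖ ^ n ≤ ‖f w‖ ∧ 2 * ‖w‖ ≤ ‖f w‖ ∧
        1 < c * ‖w‖ ∧ ∀ t : Fin k, b ≤ (t : ℕ) → ‖f w t‖ ≤ C / ‖w‖ * ‖f w‖ := by
  obtain ⟨C₀, hC₀, hbound⟩ := hbound
  obtain ⟨C₁, hC₁, hpoly⟩ := exists_norm_eval_le P
  obtain ⟨C₂, hC₂, hlead⟩ := exists_norm_eval_sub_pPlus_le P
  obtain ⟨ε, hε, hreg⟩ := exists_lt_of_regular hreg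
  obtain ⟨p, rfl⟩ : ∃ p, n = p + 1 := ⟨n - 1, by lia⟩
  have hsmall : ∀ w ∈ K, 1 ≤ ‖w‖ → ∀ t : Fin k, (t : ℕ) < a →
      ‖eval (fun j => (‖w‖⁻¹ • w) j) (pPlus k P t)‖ ≤ (C₀ + C₂) / ‖w‖ := by
    intro w hw hw1 t ht
    have hdeg := hlow t ht
    obtain ⟨q, hq⟩ : ∃ q, (P t).totalDegree = q + 1 := ⟨(P t).totalDegree - 1, by lia⟩
    have h1 : ‖eval (fun j => w j) (P t)‖ ≤ C₀ * ‖w‖ ^ q := by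
      rw [← hf]
      refine (PiLp.norm_apply_le _ _).trans ((hbound w hw).trans ?_)
      rw [max_eq_right hw1]
      have := pow_le_pow_right₀ hw1 (show p + 1 ≤ q by lia)
      gcongr
    have h2 := hlead t w hw1
    rw [hq, Nat.add_sub_cancel] at h2
    have h3 : ‖eval (fun j => w j) (pPlus k P t)‖ ≤ (C₀ + C₂) * ‖w‖ ^ q := by
      have := norm_sub_norm_le (eval (fun j => w j) (pPlus k P t)) (eval (fun j => w j) (P t))
      rw [norm_sub_rev] at this
      linarith
    have hw0 : 0 < ‖w‖ := by linarith
    rw [norm_eval_pPlus_normalize, hq, div_le_div_iff₀ (by positivity) hw0]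
    calc _ ≤ (C₀ + C₂) * ‖w‖ ^ q * ‖w‖ := by gcongr
      _ = _ := by ring
  set c := ε / 2 with hc
  have hc0 : 0 < c := by positivity
  set C := C₀ + C₂ + C₁ / c with hCdef
  have hCC : C₀ + C₂ ≤ C := le_add_of_nonneg_right (by positivity)
  have hC0 : 0 < C := by positivity
  refine ⟨C, c, ε, 1 + 2 * C / ε + 2 / c, hC0, hc0, hε, ?_, fun w hw hw1 t ht => ?_, ?_⟩
  · have : 0 ≤ 2 * C / ε + 2 / c := by positivity
    linarith
  · exact (hsmall w hw hw1 t ht).trans (by gcongr)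
  rintro w ⟨hwK, hwR, hwt⟩
  have hC1 : 0 < 2 * C / ε := by positivity
  have hC2 : 0 < 2 / c := by positivity
  have hw1 : 1 < ‖w‖ := by linarith
  have hw0 : 0 < ‖w‖ := by linarith
  have hCw : 2 * C < ε * ‖w‖ := by
    have : 2 * C / ε < ‖w‖ := by linarith
    rwa [div_lt_iff₀' hε] at this
  have hcw : 2 < c * ‖w‖ := by
    have : 2 / c < ‖w‖ := by linarith
    rwa [div_lt_iff₀' hc0] at this
  have hCdiv : C / ‖w‖ < ε := by
    rw [div_lt_iff₀ hw0]
    linarith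
  have hgrow : c * ‖w‖ ^ (p + 1) ≤ ‖f w‖ := by
    have hunit : ‖‖w‖⁻¹ • w‖ = 1 := by
      rw [norm_smul, norm_inv, norm_norm, inv_mul_cancel₀ hw0.ne']
    rcases hreg _ hunit with ⟨t, htb, ht⟩ | ⟨t, htb, ht⟩
    · have hat : a ≤ (t : ℕ) := by
        by_contra! hta
        have := (hsmall w hwK hw1.le t hta).trans (show _ ≤ C / ‖w‖ by gcongr)
        linarith
      have hdeg := hmid t hat htb
      rw [norm_eval_pPlus_normalize, hdeg, lt_div_iff₀ (by positivity)] at ht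
      have h2 := hlead t w hw1.le
      rw [hdeg, Nat.add_sub_cancel] at h2
      have h3 : C₂ * ‖w‖ ^ p ≤ c * ‖w‖ ^ (p + 1) := by
        rw [pow_succ', ← mul_assoc]
        have : 0 ≤ C₁ / c := by positivity
        have : C₂ ≤ c * ‖w‖ := by
          rw [hc]
          linarith
        gcongr
      have h4 := norm_sub_norm_le (eval (fun j => w j) (pPlus k P t)) (eval (fun j => w j) (P t))
      rw [norm_sub_rev] at h4
      have h5 := PiLp.norm_apply_le (f w) t
      rw [hf] at h5
      have h6 : ε * ‖w‖ ^ (p + 1) = c * ‖w‖ ^ (p + 1) + c * ‖w‖ ^ (p + 1) := by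
        rw [hc]
        ring
      linarith
    · have := hwt t htb
      rw [PiLp.smul_apply, norm_smul, norm_inv, norm_norm, lt_inv_mul_iff₀ hw0] at ht
      linarith
  have hdouble : 2 * ‖w‖ ≤ ‖f w‖ := by
    refine le_trans ?_ hgrow
    rw [pow_succ', ← mul_assoc]
    have : ‖w‖ ≤ ‖w‖ ^ p := le_self_pow₀ hw1.le (by lia)
    gcongr
  have hfw0 : 0 < ‖f w‖ := by linarith
  have hcoord : ∀ t : Fin k, b ≤ (t : ℕ) → ‖f w t‖ ≤ C / ‖w‖ * ‖f w‖ := by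
    intro t ht
    rw [hf]
    calc _ ≤ C₁ * ‖w‖ ^ p := hpoly t p (by have := hhigh t ht; lia) w _ hw1.le le_rfl
      _ = (C₁ / c) / ‖w‖ * (c * ‖w‖ ^ (p + 1)) := by
        field_simp
        exact (pow_succ _ _).symm
      _ ≤ C / ‖w‖ * ‖f w‖ := by
        have : C₁ / c ≤ C := by linarith
        gcongr
  refine ⟨⟨by linarith, fun t ht => (hcoord t ht).trans_lt ?_⟩, hgrow, hdouble, by linarith, hcoord⟩
  gcongr

theorem exists_bound_of_not_mem_trap {b n : ℕ} {R ε : ℝ} (hR : 1 ≤ R) (hε : 0 < ε)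
    (hf : ∀ z j, f z j = eval (fun t => z t) (P j))
    (hhigh : ∀ t : Fin k, b ≤ (t : ℕ) → (P t).totalDegree ≤ n) :
    ∃ C : ℝ, 0 < C ∧ ∀ w, f w ∉ trap k b R ε → ‖f w‖ ≤ C * max 1 ‖w‖ ^ n := by
  obtain ⟨C₁, hC₁, hpoly⟩ := exists_norm_eval_le P
  refine ⟨R + C₁ / ε, by positivity, fun w hw => ?_⟩
  have hM : 1 ≤ max 1 ‖w‖ ^ n := one_le_pow₀ (le_max_left _ _)
  have hC : 0 ≤ C₁ / ε := by positivity
  by_cases hwR : ‖f w‖ ≤ R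
  · nlinarith
  · obtain ⟨t, ht, hwt⟩ : ∃ t : Fin k, b ≤ (t : ℕ) ∧ ε * ‖f w‖ ≤ ‖f w t‖ := by
      by_contra! H
      exact hw ⟨not_le.1 hwR, H⟩
    rw [hf] at hwt
    have h := hwt.trans (hpoly t n (hhigh t ht) w _ (le_max_left 1 ‖w‖) (le_max_right _ _))
    rw [← le_div_iff₀' hε, mul_div_right_comm] at h
    nlinarith

variable {l : ℕ → ℕ} {i : ℕ}

theorem mem_sigmaSet_iff {u : EuclideanSpace ℂ (Fin k)} : u ∈ sigmaSet k P l i ↔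
    u ∈ sphere (0 : EuclideanSpace ℂ (Fin k)) 1 ∧ coneGauge k P (l (i - 1)) (l i) u = 0 := by
  rw [coneGauge_eq_zero_iff, mem_sphere_zero_iff_norm]
  rfl

theorem isClosed_sigmaSet : IsClosed (sigmaSet k P l i) := by
  have : sigmaSet k P l i = sphere (0 : EuclideanSpace ℂ (Fin k)) 1 ∩
      coneGauge k P (l (i - 1)) (l i) ⁻¹' {0} := by
    ext u
    exact mem_sigmaSet_iff
  rw [this]
  exact isClosed_sphere.inter (isClosed_singleton.preimage continuous_coneGauge)

theorem eventually_normalize_mem_sphere {E : Type*} [NormedAddCommGroup E] [NormedSpace ℝ E]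
    {w : ℕ → E} (hw : Tendsto (fun n => ‖w n‖) atTop atTop) :
    ∀ᶠ n in atTop, ‖w n‖⁻¹ • w n ∈ sphere (0 : E) 1 := by
  filter_upwards [hw.eventually_gt_atTop 0] with n hn
  rw [mem_sphere_zero_iff_norm, norm_smul, norm_inv, norm_norm, inv_mul_cancel₀ hn.ne']

theorem mem_basin_of_tendsto_coneGauge {z : EuclideanSpace ℂ (Fin k)}
    (hz : Tendsto (fun n => ‖f^[n] z‖) atTop atTop)
    (hg : Tendsto (fun n => coneGauge k P (l (i - 1)) (l i) (‖f^[n] z‖⁻¹ • f^[n] z)) atTop (𝓝 0)) :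
    z ∈ basin k f P l i :=
  ⟨hz, tendsto_zero_of_isCompact (isCompact_sphere 0 1) continuous_coneGauge (continuous_infDist_pt _)
    coneGauge_nonneg (fun _ => infDist_nonneg)
    (fun _ hu h0 => infDist_zero_of_mem (mem_sigmaSet_iff.2 ⟨hu, h0⟩))
    (eventually_normalize_mem_sphere hz) hg⟩

theorem tendsto_coneGauge_of_mem_basin (hne : (sigmaSet k P l i).Nonempty)
    {z : EuclideanSpace ℂ (Fin k)} (hz : z ∈ basin k f P l i) :
    Tendsto (fun n => coneGauge k P (l (i - 1)) (l i) (‖f^[n] z‖⁻¹ • f^[n] z)) atTop (𝓝 0) :=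
  tendsto_zero_of_isCompact (isCompact_sphere 0 1) (continuous_infDist_pt _) continuous_coneGauge
    (fun _ => infDist_nonneg) coneGauge_nonneg
    (fun _ _ h0 => (mem_sigmaSet_iff.1
      ((isClosed_sigmaSet.mem_iff_infDist_zero hne).2 h0)).2)
    (eventually_normalize_mem_sphere hz.1) hz.2

theorem exists_iterate_mem_trap (hne : (sigmaSet k P l i).Nonempty) {R ε : ℝ} (hε : 0 < ε)
    {z : EuclideanSpace ℂ (Fin k)} (hz : z ∈ basin k f P l i) :
    ∃ N, f^[N] z ∈ trap k (l i) R ε := by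
  obtain ⟨N, hN, hNR, hN0⟩ := (((tendsto_coneGauge_of_mem_basin hne hz).eventually
    (gt_mem_nhds hε)).and ((hz.1.eventually_gt_atTop R).and (hz.1.eventually_gt_atTop 0))).exists
  refine ⟨N, hNR, fun t ht => ?_⟩
  have h := (norm_apply_le_coneGauge (a := l (i - 1)) (P := P) _ ht).trans_lt hN
  rw [PiLp.smul_apply, norm_smul, norm_inv, norm_norm, inv_mul_lt_iff₀ hN0] at h
  linarith

theorem mem_basin_of_mem_trap {K : Set (EuclideanSpace ℂ (Fin k))} (hK : MapsTo f K K)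
    {C R ε : ℝ} (hR : 1 ≤ R)
    (hlow : ∀ w ∈ K, 1 ≤ ‖w‖ → ∀ t : Fin k, (t : ℕ) < l (i - 1) →
      ‖eval (fun j => (‖w‖⁻¹ • w) j) (pPlus k P t)‖ ≤ C / ‖w‖)
    (htrap : MapsTo f (K ∩ trap k (l i) R ε) (trap k (l i) R ε))
    (hdouble : ∀ w ∈ K ∩ trap k (l i) R ε, 2 * ‖w‖ ≤ ‖f w‖)
    (hhigh : ∀ w ∈ K ∩ trap k (l i) R ε, ∀ t : Fin k, l i ≤ (t : ℕ) →
      ‖f w t‖ ≤ C / ‖w‖ * ‖f w‖)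
    {w : EuclideanSpace ℂ (Fin k)} (hw : w ∈ K ∩ trap k (l i) R ε) :
    w ∈ basin k f P l i := by
  have hmem : ∀ n, f^[n] w ∈ K ∩ trap k (l i) R ε := fun n =>
    (show MapsTo f (K ∩ trap k (l i) R ε) (K ∩ trap k (l i) R ε) from
      fun x hx => ⟨hK hx.1, htrap hx⟩).iterate n hw
  have hone : ∀ n, 1 ≤ ‖f^[n] w‖ := fun n => hR.trans (hmem n).2.1.le
  have hgrow : ∀ n : ℕ, (2 : ℝ) ^ n ≤ ‖f^[n] w‖ := by
    intro n
    induction n with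
    | zero => simpa using hone 0
    | succ n ih =>
      rw [Function.iterate_succ_apply', pow_succ']
      exact le_trans (by gcongr) (hdouble _ (hmem n))
  have hinf : Tendsto (fun n => ‖f^[n] w‖) atTop atTop :=
    tendsto_atTop_mono hgrow (tendsto_pow_atTop_atTop_of_one_lt one_lt_two)
  have hC : Tendsto (fun n => C / ‖f^[n] w‖) atTop (𝓝 0) := hinf.const_div_atTop C
  refine mem_basin_of_tendsto_coneGauge hinf ?_
  rw [← Finset.sum_const_zero (s := Finset.univ (α := Fin k))]
  refine tendsto_finsetSum _ fun t _ => ?_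
  refine Tendsto.mono_right (Tendsto.add (a := (0 : ℝ)) (b := 0) ?_ ?_) (by rw [add_zero])
  · split_ifs with ht
    · exact squeeze_zero (fun _ => norm_nonneg _) (fun n => hlow _ (hmem n).1 (hone n) t ht) hC
    · exact tendsto_const_nhds
  · split_ifs with ht
    · refine (tendsto_add_atTop_iff_nat 1).1
        (squeeze_zero (fun _ => norm_nonneg _) (fun n => ?_) hC)
      have h0 : 0 < ‖f^[n + 1] w‖ := by linarith [hone (n + 1)]
      rw [PiLp.smul_apply, norm_smul, norm_inv, norm_norm, inv_mul_le_iff₀ h0, mul_comm,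
        Function.iterate_succ_apply']
      exact hhigh _ (hmem n) t ht
    · exact tendsto_const_nhds

theorem apply_mem_basin_iff {z : EuclideanSpace ℂ (Fin k)} :
    f z ∈ basin k f P l i ↔ z ∈ basin k f P l i := by
  refine and_congr ?_ ?_
  · exact tendsto_add_atTop_iff_nat (f := fun n => ‖f^[n] z‖) 1
  · exact tendsto_add_atTop_iff_nat
      (f := fun n => infDist (‖f^[n] z‖⁻¹ • f^[n] z) (sigmaSet k P l i)) 1

theorem mapsTo_kSet : MapsTo f (kSet k f P l i) (kSet k f P l i) :=
  fun _ hz j hj hji => apply_mem_basin_iff.not.2 (hz j hj hji)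

theorem kSet_succ (i : ℕ) : kSet k f P l (i + 1) = kSet k f P l i \ basin k f P l (i + 1) := by
  ext z
  refine ⟨fun h => ⟨fun j hj hji => h j hj (by lia), h _ (by lia) le_rfl⟩, fun h j hj hji => ?_⟩
  rcases Nat.lt_or_ge i j with hij | hij
  · obtain rfl : j = i + 1 := by lia
    exact h.2
  · exact h.1 j hj hij

theorem sigmaSet_nonempty (hP : ∀ t, 1 ≤ (P t).totalDegree) (hl : l (i - 1) < l i)
    (hlk : l i ≤ k) : (sigmaSet k P l i).Nonempty := by
  let S := {t : Fin k // (t : ℕ) < l (i - 1) ∨ l i ≤ (t : ℕ)}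
  let F : S → MvPolynomial (Fin k) ℂ := fun t =>
    if (t.1 : ℕ) < l (i - 1) then pPlus k P t.1 else X t.1
  have hcard : Fintype.card S < k := by
    have := Fintype.card_subtype_lt (p := fun t : Fin k => (t : ℕ) < l (i - 1) ∨ l i ≤ (t : ℕ))
      (x := ⟨l (i - 1), by lia⟩) (by simpa using hl)
    simpa using this
  have hhom := fun t => homogeneousComponent_isHomogeneous (P t).totalDegree (P t)
  obtain ⟨z, hz0, hz⟩ := exists_ne_zero_common_zero F (fun t => by
    dsimp only [F]
    split_ifs
    · have h := (hhom t.1).eval_mul_left 0 0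
      simp only [zero_mul, zero_pow (Nat.one_le_iff_ne_zero.1 (hP t.1))] at h
      exact h
    · simp) hcard
  let w : EuclideanSpace ℂ (Fin k) := WithLp.toLp 2 z
  have hw0 : ‖w‖ ≠ 0 := by
    rw [norm_ne_zero_iff]
    intro h
    apply hz0
    ext j
    exact congrFun (congrArg WithLp.ofLp h) j
  refine ⟨‖w‖⁻¹ • w, ?_, fun t ht => ?_, fun t ht => ?_⟩
  · rw [norm_smul, norm_inv, norm_norm, inv_mul_cancel₀ hw0]
  · have h := hz ⟨t, Or.inl ht⟩
    simp only [F, if_pos ht] at h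
    rw [← norm_eq_zero, norm_eval_pPlus_normalize, div_eq_zero_iff, norm_eq_zero]
    exact Or.inl h
  · have h := hz ⟨t, Or.inr ht⟩
    simp only [F, if_neg (show ¬ (t : ℕ) < l (i - 1) by lia), eval_X] at h
    simp [w, h]

end Trap

theorem logPlus_le_of_norm_le {E : Type*} [NormedAddCommGroup E] {x y : E} {C : ℝ} {n : ℕ}
    (hC : 0 < C) (h : ‖y‖ ≤ C * max 1 ‖x‖ ^ n) :
    logPlus ‖y‖ ≤ (|Real.log C| + 1) + n * logPlus ‖x‖ := by
  have hlog := Real.posLog_eq_log_max_one (norm_nonneg x)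
  rw [← logPlus_eq_posLog] at hlog
  refine max_le ?_ (add_nonneg (by positivity) (mul_nonneg n.cast_nonneg (logPlus_nonneg _)))
  rcases (norm_nonneg y).eq_or_lt with hy | hy
  · rw [← hy, Real.log_zero]
    exact add_nonneg (by positivity) (mul_nonneg n.cast_nonneg (logPlus_nonneg _))
  · have hmax : 0 < max 1 ‖x‖ := by positivity
    have h1 := Real.log_le_log hy h
    rw [Real.log_mul hC.ne' (by positivity), Real.log_pow, ← hlog] at h1
    linarith [le_abs_self (Real.log C)]

theorem le_logPlus_of_le_norm {E : Type*} [NormedAddCommGroup E] {x y : E} {c : ℝ} {n : ℕ}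
    (hc : 0 < c) (hx : 1 ≤ ‖x‖) (h : c * ‖x‖ ^ n ≤ ‖y‖) :
    n * logPlus ‖x‖ ≤ logPlus ‖y‖ + max 0 (-Real.log c) := by
  have h0 : 0 < ‖x‖ := by linarith
  have h1 := Real.log_le_log (by positivity) h
  rw [Real.log_mul hc.ne' (by positivity), Real.log_pow] at h1
  rw [show logPlus ‖x‖ = Real.log ‖x‖ from max_eq_left (Real.log_nonneg hx)]
  have h2 : Real.log ‖y‖ ≤ logPlus ‖y‖ := le_max_left _ _
  linarith [le_max_right 0 (-Real.log c)]

theorem max_neg_log_lt_logPlus {c r : ℝ} (hc : 0 < c) (hr : 1 < r) (h : 1 < c * r) :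
    max 0 (-Real.log c) < logPlus r := by
  have h1 := Real.log_pos h
  rw [Real.log_mul hc.ne' (by positivity)] at h1
  have h2 := Real.log_pos hr
  exact (max_lt h2 (by linarith)).trans_le (le_max_left _ _)

/-- If `l 0 = 0`, every index below `l r` lies in a block `[l (j - 1), l j)` with `j ≤ r`. -/
theorem exists_block {l : ℕ → ℕ} (hl0 : l 0 = 0) {t r : ℕ} (ht : t < l r) :
    ∃ j, 1 ≤ j ∧ j ≤ r ∧ l (j - 1) ≤ t ∧ t < l j := by
  induction r with
  | zero => lia
  | succ r ih =>
    by_cases h : t < l r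
    · obtain ⟨j, h1, h2, h3⟩ := ih h
      exact ⟨j, h1, by lia, h3⟩
    · exact ⟨r + 1, by lia, le_rfl, by simpa using h, ht⟩

/-- (Theorem 2.1, first part.) For a proper `s`-regular map and
`1 ≤ i ≤ s` (with `i < m` or `d_m ≥ 2`): there are positive `c_{i,n} → 0` such that
`G_{i,n} + c_{i,n}` is nonincreasing on `K_{i−1}`; the limit `G_i` is finite,
nonnegative and continuous on `K_{i−1}`, satisfies `G_i ∘ f = d_i·G_i` and
`G_i(z) ≤ log⁺‖z‖ + c_{i,0}` there, vanishes exactly on `K_i`, and is positive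
on `U_i`. -/
theorem stmt7 (k m s : ℕ) (hk : 0 < k)
    (l : ℕ → ℕ) (hl0 : l 0 = 0) (hlm : l m = k)
    (hlmono : ∀ i < m, l i < l (i + 1))
    (P : Fin k → MvPolynomial (Fin k) ℂ)
    (d : ℕ → ℕ)
    (hdeg : ∀ i, 1 ≤ i → i ≤ m → ∀ j : Fin k,
      l (i - 1) ≤ (j : ℕ) → (j : ℕ) < l i → (P j).totalDegree = d i)
    (hdmono : ∀ i, 1 ≤ i → i < m → d (i + 1) < d i)
    (hdm : 1 ≤ d m)
    (f : EuclideanSpace ℂ (Fin k) → EuclideanSpace ℂ (Fin k))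
    (hf : ∀ (z : EuclideanSpace ℂ (Fin k)) (j : Fin k),
      f z j = eval (fun t => z t) (P j))
    (hproper : IsProperMap f)
    (hs1 : 1 ≤ s) (hsm : s ≤ m)
    (hreg : ∀ r, 1 ≤ r → r ≤ s → ∀ z : Fin k → ℂ,
      (∀ j : Fin k, (j : ℕ) < l r → eval z (pPlus k P j) = 0) →
      (∀ j : Fin k, l r ≤ (j : ℕ) → z j = 0) → z = 0)
    (i : ℕ) (hi1 : 1 ≤ i) (his : i ≤ s)
    (hcase : i < m ∨ 2 ≤ d m) :
    ∃ cseq : ℕ → ℝ, (∀ n, 0 < cseq n) ∧ Tendsto cseq atTop (𝓝 0) ∧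
      (∀ z ∈ kSet k f P l (i - 1), Antitone fun n : ℕ =>
        ((d i : ℝ) ^ n)⁻¹ * logPlus ‖f^[n] z‖ + cseq n) ∧
      ∃ G : EuclideanSpace ℂ (Fin k) → ℝ,
        (∀ z ∈ kSet k f P l (i - 1),
          Tendsto (fun n : ℕ => ((d i : ℝ) ^ n)⁻¹ * logPlus ‖f^[n] z‖) atTop (𝓝 (G z)) ∧
          0 ≤ G z ∧ G (f z) = (d i : ℝ) * G z ∧ G z ≤ logPlus ‖z‖ + cseq 0) ∧
        ContinuousOn G (kSet k f P l (i - 1)) ∧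
        {z ∈ kSet k f P l (i - 1) | G z = 0} = kSet k f P l i ∧
        ∀ z ∈ basin k f P l i, 0 < G z := by
  have hanti : ∀ p r, 1 ≤ p → p ≤ r → r ≤ m → d r + (r - p) ≤ d p := by
    intro p r hp hpr
    induction r, hpr using Nat.le_induction with
    | base => lia
    | succ r hpr ih =>
      intro hrm
      have := hdmono r (by lia) (by lia)
      have := ih (by lia)
      lia
  have hlle : ∀ p r, p ≤ r → r ≤ m → l p ≤ l r := by
    intro p r hpr
    induction r, hpr using Nat.le_induction with
    | base => lia
    | succ r hpr ih =>
      intro hrm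
      have := hlmono r (by lia)
      have := ih (by lia)
      lia
  let e : ℕ → ℕ := fun j => if j ≤ m then d j else 0
  have hdegt : ∀ t : Fin k, ∃ j, 1 ≤ j ∧ j ≤ m ∧ l (j - 1) ≤ (t : ℕ) ∧ (t : ℕ) < l j ∧
      (P t).totalDegree = d j := by
    intro t
    obtain ⟨j, h1, h2, h3, h4⟩ := exists_block hl0 (hlm.symm ▸ t.2 : (t : ℕ) < l m)
    exact ⟨j, h1, h2, h3, h4, hdeg j h1 h2 t h3 h4⟩
  have hhigh : ∀ r ≤ m, ∀ t : Fin k, l r ≤ (t : ℕ) → (P t).totalDegree ≤ e (r + 1) := by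
    intro r hr t ht
    obtain ⟨j, h1, h2, h3, h4, h5⟩ := hdegt t
    have hrj : r < j := by
      by_contra! h
      have := hlle j r h hr
      lia
    have := hanti (r + 1) j (by lia) hrj h2
    simp only [e, if_pos (show r + 1 ≤ m by lia)]
    lia
  have hlow : ∀ r < m, ∀ t : Fin k, (t : ℕ) < l r → d (r + 1) < (P t).totalDegree := by
    intro r hr t ht
    obtain ⟨j, h1, h2, h3, h4⟩ := exists_block hl0 ht
    have := hdeg j h1 (by lia) t h3 h4
    have := hanti j (r + 1) h1 (by lia) (by lia)
    lia
  have hd2 : ∀ r < i, 2 ≤ d (r + 1) := by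
    intro r hr
    have := hanti (r + 1) m (by lia) (by lia) le_rfl
    lia
  have he : ∀ r < i, e (r + 2) < d (r + 1) := by
    intro r hr
    simp only [e]
    split_ifs with h
    · exact hdmono (r + 1) (by lia) (by lia)
    · have := hd2 r hr
      lia
  have hP1 : ∀ t, 1 ≤ (P t).totalDegree := by
    intro t
    obtain ⟨j, h1, h2, -, -, h5⟩ := hdegt t
    have := hanti j m h1 h2 le_rfl
    lia
  have htrap : ∀ r < i,
      (∃ C : ℝ, 0 < C ∧ ∀ w ∈ kSet k f P l r, ‖f w‖ ≤ C * max 1 ‖w‖ ^ d (r + 1)) →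
      ∃ c ε R : ℝ, 0 < c ∧ 0 < ε ∧ 1 ≤ R ∧
        ∀ w ∈ kSet k f P l r ∩ trap k (l (r + 1)) R ε, w ∈ basin k f P l (r + 1) ∧
          f w ∈ trap k (l (r + 1)) R ε ∧ c * ‖w‖ ^ d (r + 1) ≤ ‖f w‖ ∧ 1 < c * ‖w‖ := by
    intro r hr hbound
    obtain ⟨C, c, ε, R, hC, hc, hε, hR, hsmall, hw⟩ := exists_trap hf (hd2 r hr)
      (hlow r (by lia)) (fun t h1 h2 => hdeg (r + 1) (by lia) (by lia) t h1 h2)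
      (fun t ht => (hhigh (r + 1) (by lia) t ht).trans_lt (he r hr))
      (hreg (r + 1) (by lia) (by lia)) hbound
    exact ⟨c, ε, R, hc, hε, hR, fun w hwK => ⟨mem_basin_of_mem_trap mapsTo_kSet hR hsmall
      (fun x hx => (hw x hx).1) (fun x hx => (hw x hx).2.2.1)
      (fun x hx => (hw x hx).2.2.2.2) hwK, (hw w hwK).1, (hw w hwK).2.1, (hw w hwK).2.2.2.1⟩⟩
  have hbound : ∀ r ≤ i,
      ∃ C : ℝ, 0 < C ∧ ∀ w ∈ kSet k f P l r, ‖f w‖ ≤ C * max 1 ‖w‖ ^ e (r + 1) := by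
    intro r
    induction r with
    | zero =>
      intro _
      obtain ⟨C, hC, hpoly⟩ := exists_norm_eval_le P
      refine ⟨C * (k + 1), by positivity, fun w _ => ?_⟩
      have hcoord : ∀ t, ‖f w t‖ ≤ C * max 1 ‖w‖ ^ e 1 := fun t => by
        rw [hf]
        exact hpoly t _ (hhigh 0 (by lia) t (by simp [hl0])) w _ (le_max_left _ _)
          (le_max_right _ _)
      have hsum : ‖f w‖ ≤ ∑ t, ‖f w t‖ := by
        conv_lhs => rw [← (EuclideanSpace.basisFun (Fin k) ℂ).sum_repr (f w)]
        refine (norm_sum_le _ _).trans (Finset.sum_le_sum fun t _ => ?_)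
        rw [norm_smul]
        simp
      calc ‖f w‖ ≤ ∑ _t : Fin k, C * max 1 ‖w‖ ^ e 1 :=
            hsum.trans (Finset.sum_le_sum fun t _ => hcoord t)
        _ = k * (C * max 1 ‖w‖ ^ e 1) := by simp
        _ ≤ C * (k + 1) * max 1 ‖w‖ ^ e 1 := by
          have : 0 ≤ C * max 1 ‖w‖ ^ e 1 := by positivity
          linarith
    | succ r ih =>
      intro hr
      have her : e (r + 1) = d (r + 1) := if_pos (by lia)
      have hih := ih (by lia)
      rw [her] at hih
      obtain ⟨c, ε, R, -, hε, hR, hw⟩ := htrap r hr hih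
      obtain ⟨C, hC, hb⟩ := exists_bound_of_not_mem_trap (P := P) (f := f) hR hε hf
        (hhigh (r + 1) (by lia))
      refine ⟨C, hC, fun w hwK => hb w fun hft => ?_⟩
      have hfw := mapsTo_kSet hwK
      rw [kSet_succ] at hfw
      exact hfw.2 (hw _ ⟨hfw.1, hft⟩).1
  obtain ⟨r, rfl⟩ : ∃ r, i = r + 1 := ⟨i - 1, by lia⟩
  have her : e (r + 1) = d (r + 1) := if_pos (by lia)
  have hr := hbound r (by lia)
  rw [her] at hr
  obtain ⟨C, hC, hup⟩ := hr
  obtain ⟨C', hC', hslow⟩ := hbound (r + 1) le_rfl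
  obtain ⟨c, ε, R, hc, hε, hR, hw⟩ := htrap r (by lia) ⟨C, hC, hup⟩
  have hne : (sigmaSet k P l (r + 1)).Nonempty := by
    refine sigmaSet_nonempty hP1 ?_ ?_
    · simpa using hlmono r (by lia)
    · rw [← hlm]
      exact hlle _ _ (by lia) le_rfl
  rw [Nat.add_sub_cancel, kSet_succ]
  refine exists_green_function hproper.continuous (isOpen_trap k (l (r + 1)) R ε)
    mapsTo_kSet (by rw [← kSet_succ]; exact mapsTo_kSet) (hd2 r (by lia))
    (A' := |Real.log C'| + 1) (by positivity : 0 < |Real.log C| + 1)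
    (le_max_left 0 (-Real.log c)) (fun w hwK => logPlus_le_of_norm_le hC (hup w hwK))
    (fun w hwK => (hw w hwK).2.1)
    (fun w hwK => le_logPlus_of_le_norm hc (hR.trans hwK.2.1.le) (hw w hwK).2.2.1)
    (fun w hwK => max_neg_log_lt_logPlus hc (hR.trans_lt hwK.2.1) (hw w hwK).2.2.2)
    (fun z hz => exists_iterate_mem_trap hne hε hz.2) fun z hz => ?_
  rw [← kSet_succ] at hz
  refine (logPlus_le_of_norm_le hC' (hslow z hz)).trans ?_
  have hcast : (e (r + 2) : ℝ) + 1 ≤ d (r + 1) := by exact_mod_cast he r (by lia)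
  have := mul_le_mul_of_nonneg_right (le_sub_iff_add_le.2 hcast) (logPlus_nonneg ‖z‖)
  linarith
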